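/- A martingale coupling π of probability measures μ, ν ∈ M is left-monotone if and only if the following condition holds: for every (x, y⁺), (x, y⁻), (x′, y′) ∈ spt*(π) with x < x′ and y⁻ < y⁺, one has y′ ∉ (y⁻, y⁺). (Characterization of left-monotonicity by the reduced support spt*(π), which has full π-measure and is contained in spt(π).) -/

import Mathlib

open MeasureTheory Set Filter ProbabilityTheory

noncomputable section

/-- A function has at most linear growth. -/
def LinGrowth (φ : ℝ → ℝ) : Prop := ∃ C : ℝ, ∀ x : ℝ, |φ x| ≤ C * (1 + |x|)

/-- Membership in `M`: finite positive Borel measure on `ℝ` with finite first moment. -/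
def MemM (μ : Measure ℝ) : Prop := IsFiniteMeasure μ ∧ Integrable (fun x => x) μ

/-- Stochastic order `≤_sto`. -/
def leSto (μ ν : Measure ℝ) : Prop :=
  ∀ φ : ℝ → ℝ, LinGrowth φ → Monotone φ → ∫ x, φ x ∂μ ≤ ∫ x, φ x ∂ν

/-- Convex order `≤_C`. -/
def leC (μ ν : Measure ℝ) : Prop :=
  ∀ φ : ℝ → ℝ, LinGrowth φ → ConvexOn ℝ Set.univ φ → ∫ x, φ x ∂μ ≤ ∫ x, φ x ∂ν

/-- Order `≤_{C,+}` (extended order). -/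
def leCP (μ ν : Measure ℝ) : Prop :=
  ∀ φ : ℝ → ℝ, LinGrowth φ → ConvexOn ℝ Set.univ φ → (∀ x, 0 ≤ φ x) →
    ∫ x, φ x ∂μ ≤ ∫ x, φ x ∂ν

/-- Order `≤_{sto,+}`. -/
def leStoP (μ ν : Measure ℝ) : Prop :=
  ∀ φ : ℝ → ℝ, LinGrowth φ → Monotone φ → (∀ x, 0 ≤ φ x) →
    ∫ x, φ x ∂μ ≤ ∫ x, φ x ∂ν

/-- Order `≤_{C,sto}`. -/
def leCS (μ ν : Measure ℝ) : Prop :=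
  ∀ φ : ℝ → ℝ, LinGrowth φ → ConvexOn ℝ Set.univ φ → Monotone φ →
    ∫ x, φ x ∂μ ≤ ∫ x, φ x ∂ν

/-- Order `≤_{C,+,sto}`. -/
def leCPS (μ ν : Measure ℝ) : Prop :=
  ∀ φ : ℝ → ℝ, LinGrowth φ → ConvexOn ℝ Set.univ φ → (∀ x, 0 ≤ φ x) → Monotone φ →
    ∫ x, φ x ∂μ ≤ ∫ x, φ x ∂ν

/-- The Kantorovich distance. -/
def W (μ ν : Measure ℝ) : ℝ :=
  sSup {d : ℝ | ∃ f : ℝ → ℝ, LipschitzWith 1 f ∧ d = |∫ x, f x ∂μ - ∫ x, f x ∂ν|}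

/-- Quantile function `G_ν`. -/
def quantile (ν : Measure ℝ) (t : ℝ) : ℝ := sInf {x : ℝ | t ≤ (ν (Set.Iic x)).toReal}

/-- `IsShadow μ ν η` means `η = S^ν(μ)`, the shadow of `μ` in `ν`. -/
def IsShadow (μ ν η : Measure ℝ) : Prop :=
  leC μ η ∧ η ≤ ν ∧ ∀ η' : Measure ℝ, leC μ η' → η' ≤ ν → leC η η'

/-- `Top(μ,ν)`: pushforward of Lebesgue measure on `(0, m]` by `max (G_μ) (G_ν)`. -/
def TopMeas (μ ν : Measure ℝ) : Measure ℝ :=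
  Measure.map (fun t => max (quantile μ t) (quantile ν t))
    (volume.restrict (Set.Ioc (0:ℝ) (μ Set.univ).toReal))

/-- `Down(μ,ν)`: pushforward of Lebesgue measure on `(0, m]` by `min (G_μ) (G_ν)`. -/
def DownMeas (μ ν : Measure ℝ) : Measure ℝ :=
  Measure.map (fun t => min (quantile μ t) (quantile ν t))
    (volume.restrict (Set.Ioc (0:ℝ) (μ Set.univ).toReal))

/-- Support of a measure on a topological space. -/
def mSupport {α : Type*} [TopologicalSpace α] [MeasurableSpace α] (μ : Measure α) : Set α :=
  {x | ∀ U ∈ nhds x, μ U ≠ 0}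

/-- Positive part (Jordan decomposition) of the signed measure `η - μ`. -/
def posPartSub (η μ : Measure ℝ) [IsFiniteMeasure η] [IsFiniteMeasure μ] : Measure ℝ :=
  (η.toSignedMeasure - μ.toSignedMeasure).toJordanDecomposition.posPart

/-- `π` is a martingale coupling of `μ` and `ν`. -/
def IsMartCoupling (π : Measure (ℝ × ℝ)) (μ ν : Measure ℝ) : Prop :=
  IsProbabilityMeasure π ∧ π.fst = μ ∧ π.snd = ν ∧
    ∀ f : ℝ → ℝ, Continuous f → (∃ C : ℝ, ∀ x, |f x| ≤ C) →
      ∫ p : ℝ × ℝ, f p.1 * (p.2 - p.1) ∂π = 0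

/-- A coupling is left-monotone. -/
def LeftMonotone (π : Measure (ℝ × ℝ)) : Prop :=
  ∃ Γ : Set (ℝ × ℝ), MeasurableSet Γ ∧ π Γ = 1 ∧
    ∀ x ym yp x' y' : ℝ, (x, ym) ∈ Γ → (x, yp) ∈ Γ → (x', y') ∈ Γ →
      x < x' → ym < yp → y' ∉ Set.Ioo ym yp

/-- The set `A` of points `x` with `π((-∞,x) × (x,∞)) = 0`. -/
def jumpSet (π : Measure (ℝ × ℝ)) : Set ℝ := {x | π (Set.Iio x ×ˢ Set.Ioi x) = 0}

/-- The set `A⁻` of points of `A` isolated on the right in `A`. -/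
def jumpSetMinus (π : Measure (ℝ × ℝ)) : Set ℝ :=
  {x ∈ jumpSet π | ∃ ε > 0, Set.Ioo x (x + ε) ∩ jumpSet π = ∅}

/-- Normalised fiber measure `π_x`. -/
def fiberMeasure (π : Measure (ℝ × ℝ)) (x : ℝ) : Measure ℝ :=
  (π.fst {x})⁻¹ • Measure.snd (π.restrict ({x} ×ˢ Set.univ))

/-- The reduced support `spt* π`. -/
def sptStar (π : Measure (ℝ × ℝ)) : Set (ℝ × ℝ) :=
  (mSupport π \ (jumpSetMinus π ×ˢ (Set.univ : Set ℝ))) ∪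
    ⋃ x ∈ {x : ℝ | 0 < π.fst {x}}, {x} ×ˢ mSupport (fiberMeasure π x)


/-- Both the positive and the negative part of the increment of a martingale coupling have the same
integral over the cylinder above a Borel set. -/
theorem IsMartCoupling.setLIntegral_eq {π : Measure (ℝ × ℝ)} {μ ν : Measure ℝ}
    (hπ : IsMartCoupling π μ ν) (hμ : MemM μ) (hν : MemM ν) {B : Set ℝ} (hB : MeasurableSet B) :
    ∫⁻ p in Prod.fst ⁻¹' B, ENNReal.ofReal (p.2 - p.1) ∂π =
      ∫⁻ p in Prod.fst ⁻¹' B, ENNReal.ofReal (p.1 - p.2) ∂π := by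
  obtain ⟨hprob, rfl, rfl, hmart⟩ := hπ
  have hfst : Integrable (fun p : ℝ × ℝ => p.1) π :=
    Integrable.comp_measurable (g := fun x : ℝ => x) hμ.2 measurable_fst
  have hsnd : Integrable (fun p : ℝ × ℝ => p.2) π :=
    Integrable.comp_measurable (g := fun x : ℝ => x) hν.2 measurable_snd
  have hup : Integrable (fun p : ℝ × ℝ => p.2 - p.1) π := hsnd.sub hfst
  have hdown : Integrable (fun p : ℝ × ℝ => p.1 - p.2) π := hfst.sub hsnd
  have mup : Measurable fun p : ℝ × ℝ => ENNReal.ofReal (p.2 - p.1) := by fun_prop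
  have mdown : Measurable fun p : ℝ × ℝ => ENNReal.ofReal (p.1 - p.2) := by fun_prop
  have : IsFiniteMeasure (π.withDensity fun p => ENNReal.ofReal (p.2 - p.1)) :=
    isFiniteMeasure_withDensity_ofReal hup.2
  have : IsFiniteMeasure (π.withDensity fun p => ENNReal.ofReal (p.1 - p.2)) :=
    isFiniteMeasure_withDensity_ofReal hdown.2
  have key : (π.withDensity fun p => ENNReal.ofReal (p.2 - p.1)).map Prod.fst =
      (π.withDensity fun p => ENNReal.ofReal (p.1 - p.2)).map Prod.fst := by
    refine ext_of_forall_integral_eq_of_IsFiniteMeasure fun f => ?_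
    have hf : ∀ x, |f x| ≤ ‖f‖ := f.norm_coe_le_norm
    have hfm : AEStronglyMeasurable (fun p : ℝ × ℝ => f p.1) π :=
      (f.continuous.comp continuous_fst).aestronglyMeasurable
    have hint : ∀ g : ℝ × ℝ → ℝ, Integrable g π →
        Integrable (fun p => (ENNReal.ofReal (g p)).toReal • f p.1) π := fun g hg => by
      simp only [ENNReal.toReal_ofReal', smul_eq_mul]
      exact hg.pos_part.mul_bdd (c := ‖f‖) hfm (.of_forall fun p => hf p.1)
    rw [integral_map measurable_fst.aemeasurable (by fun_prop),
      integral_map measurable_fst.aemeasurable (by fun_prop),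
      integral_withDensity_eq_integral_toReal_smul mup (by simp),
      integral_withDensity_eq_integral_toReal_smul mdown (by simp),
      ← sub_eq_zero, ← integral_sub (hint _ hup) (hint _ hdown),
      ← hmart f f.continuous ⟨‖f‖, hf⟩]
    refine integral_congr_ae (.of_forall fun p => ?_)
    simp only [ENNReal.toReal_ofReal', smul_eq_mul]
    rcases le_total p.1 p.2 with h | h
    · rw [max_eq_left (by linarith), max_eq_right (by linarith)]; ring
    · rw [max_eq_right (by linarith), max_eq_left (by linarith)]; ring
  have := congrArg (fun m => m B) key
  simpa only [Measure.map_apply measurable_fst hB,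
    withDensity_apply _ (measurable_fst hB)] using this

/-- If the positive parts of `g` and `h` have the same integral over `s`, where `h > 0` wherever
`g < 0`, and `g < 0` almost everywhere on `s`, then `s` is null. -/
theorem measure_eq_zero_of_setLIntegral_eq {α : Type*} [MeasurableSpace α] {π : Measure α}
    {g h : α → ℝ} {s : Set α} (hs : MeasurableSet s) (hg : Measurable g) (hh : Measurable h)
    (hgh : ∀ p, g p < 0 → 0 < h p)
    (heq : ∫⁻ p in s, ENNReal.ofReal (g p) ∂π = ∫⁻ p in s, ENNReal.ofReal (h p) ∂π)
    (h0 : π (s ∩ {p | 0 ≤ g p}) = 0) : π s = 0 := by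
  have hneg : ∀ᵐ p ∂π.restrict s, g p < 0 := by
    rw [ae_restrict_iff' hs, ae_iff]
    convert h0 using 2
    ext p
    simp
  have hz : ∫⁻ p in s, ENNReal.ofReal (g p) ∂π = 0 := by
    rw [lintegral_eq_zero_iff (by fun_prop)]
    filter_upwards [hneg] with p hp using by simpa using hp.le
  rw [heq, lintegral_eq_zero_iff (by fun_prop)] at hz
  have hfalse : ∀ᵐ _ ∂π.restrict s, False := by
    filter_upwards [hneg, hz] with p hp hp'
    exact absurd (ENNReal.ofReal_eq_zero.1 hp') (not_le.2 (hgh p hp))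
  simpa [ae_iff] using hfalse

/-- If a Borel set `S` charges every non-null cylinder, then almost every vertical line meets `S`. -/
theorem ae_exists_mem_fiber {π : Measure (ℝ × ℝ)} [IsFiniteMeasure π] {S : Set (ℝ × ℝ)}
    (hS : MeasurableSet S)
    (h : ∀ B : Set ℝ, MeasurableSet B → π (Prod.fst ⁻¹' B ∩ S) = 0 → π (Prod.fst ⁻¹' B) = 0) :
    ∀ᵐ p ∂π, ∃ b, (p.1, b) ∈ S := by
  have hmeas : Measurable fun a => π.condKernel a (Prod.mk a ⁻¹' S) :=
    Kernel.measurable_kernel_prodMk_left hS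
  set B : Set ℝ := {a | π.condKernel a (Prod.mk a ⁻¹' S) = 0} with hBdef
  have hB : MeasurableSet B := hmeas (measurableSet_singleton 0)
  have hnull : π (Prod.fst ⁻¹' B ∩ S) = 0 := by
    have hdis : π (Prod.fst ⁻¹' B ∩ S) =
        (π.fst.compProd π.condKernel) (Prod.fst ⁻¹' B ∩ S) := by
      rw [π.disintegrate π.condKernel]
    rw [hdis, Measure.compProd_apply ((measurable_fst hB).inter hS), lintegral_eq_zero_iff
      (Kernel.measurable_kernel_prodMk_left ((measurable_fst hB).inter hS))]
    refine .of_forall fun a => ?_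
    by_cases ha : a ∈ B
    · exact measure_mono_null (fun b hb => hb.2) ha
    · have : Prod.mk a ⁻¹' (Prod.fst ⁻¹' B ∩ S) = ∅ := by
        ext b
        simp [ha]
      simp [this]
  have hne : ∀ᵐ p ∂π, p ∉ Prod.fst ⁻¹' B := measure_eq_zero_iff_ae_notMem.1 (h B hB hnull)
  filter_upwards [hne] with p hp
  exact nonempty_of_measure_ne_zero
    (show π.condKernel p.1 (Prod.mk p.1 ⁻¹' S) ≠ 0 from hp)

/-- For a martingale coupling carried by `Γ`, almost every fiber of `Γ` has points on both sides of
its base point. -/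
theorem IsMartCoupling.ae_exists_le_and_ge {π : Measure (ℝ × ℝ)} {μ ν : Measure ℝ}
    (hπ : IsMartCoupling π μ ν) (hμ : MemM μ) (hν : MemM ν) {Γ : Set (ℝ × ℝ)}
    (hΓ : MeasurableSet Γ) (hfull : ∀ᵐ p ∂π, p ∈ Γ) :
    ∀ᵐ p ∂π, p ∈ Γ ∧ (∃ b ≤ p.1, (p.1, b) ∈ Γ) ∧ ∃ b ≥ p.1, (p.1, b) ∈ Γ := by
  have hprob := hπ.1
  have drop : ∀ B S : Set (ℝ × ℝ), π (B ∩ (Γ ∩ S)) = 0 → π (B ∩ S) = 0 := fun B S h => by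
    rw [measure_eq_zero_iff_ae_notMem] at h ⊢
    filter_upwards [h, hfull] with p hp hp' hm using hp ⟨hm.1, hp', hm.2⟩
  have hdown : ∀ᵐ p ∂π, ∃ b, (p.1, b) ∈ Γ ∩ {q : ℝ × ℝ | 0 ≤ q.1 - q.2} :=
    ae_exists_mem_fiber (hΓ.inter (measurableSet_le (by fun_prop) (by fun_prop))) fun B hB h =>
      measure_eq_zero_of_setLIntegral_eq (measurable_fst hB) (by fun_prop) (by fun_prop)
        (fun p hp => by linarith) (hπ.setLIntegral_eq hμ hν hB).symm (drop _ _ h)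
  have hup : ∀ᵐ p ∂π, ∃ b, (p.1, b) ∈ Γ ∩ {q : ℝ × ℝ | 0 ≤ q.2 - q.1} :=
    ae_exists_mem_fiber (hΓ.inter (measurableSet_le (by fun_prop) (by fun_prop))) fun B hB h =>
      measure_eq_zero_of_setLIntegral_eq (measurable_fst hB) (by fun_prop) (by fun_prop)
        (fun p hp => by linarith) (hπ.setLIntegral_eq hμ hν hB) (drop _ _ h)
  filter_upwards [hfull, hdown, hup] with p hp ⟨b, hb, hb'⟩ ⟨c, hc, hc'⟩
  exact ⟨hp, ⟨b, sub_nonneg.1 hb', hb⟩, ⟨c, sub_nonneg.1 hc', hc⟩⟩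

theorem mSupport_eq_support {α : Type*} [TopologicalSpace α] [MeasurableSpace α] (μ : Measure α) :
    mSupport μ = μ.support := by
  ext x
  simp [mSupport, Measure.mem_support_iff_forall, pos_iff_ne_zero]

theorem fiberMeasure_apply {π : Measure (ℝ × ℝ)} {x : ℝ} {s : Set ℝ} (hs : MeasurableSet s) :
    fiberMeasure π x s = (π.fst {x})⁻¹ * π ({x} ×ˢ s) := by
  rw [fiberMeasure, Measure.smul_apply, Measure.snd_apply hs,
    Measure.restrict_apply (measurable_snd hs), smul_eq_mul]
  congr 2
  ext p
  simp [and_comm]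

/-- A neighbourhood of a point of the support of a fiber measure has positive mass on that fiber. -/
theorem measure_singleton_prod_ne_zero {π : Measure (ℝ × ℝ)} {x y : ℝ}
    (hy : y ∈ mSupport (fiberMeasure π x)) {U : Set ℝ} (hU : IsOpen U) (hyU : y ∈ U) :
    π ({x} ×ˢ U) ≠ 0 := fun h =>
  hy U (hU.mem_nhds hyU) (by rw [fiberMeasure_apply hU.measurableSet, h, mul_zero])

theorem sptStar_subset_mSupport (π : Measure (ℝ × ℝ)) : sptStar π ⊆ mSupport π := by
  rintro ⟨x, y⟩ (h | h)
  · exact h.1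
  · simp only [mem_iUnion, mem_prod, mem_singleton_iff] at h
    obtain ⟨_, -, rfl, hy⟩ := h
    intro U hU h0
    obtain ⟨V, W, hV, hxV, hW, hyW, hVW⟩ := mem_nhds_prod_iff'.1 hU
    refine measure_singleton_prod_ne_zero hy hW hyW (measure_mono_null ?_ h0)
    exact (prod_mono (singleton_subset_iff.2 hxV) subset_rfl).trans hVW

theorem countable_jumpSetMinus (π : Measure (ℝ × ℝ)) : (jumpSetMinus π).Countable := by
  refine (countable_setOfPred_isolated_right_within (s := jumpSet π)).mono ?_
  rintro x ⟨hx, ε, hε, h⟩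
  refine ⟨hx, empty_mem_iff_bot.1 (mem_nhdsWithin.2
    ⟨Iio (x + ε), isOpen_Iio, show x < x + ε by linarith, ?_⟩)⟩
  rintro z ⟨hz, hzA, hxz⟩
  exact h.subset ⟨⟨hxz, hz⟩, hzA⟩

/-- The reduced support has full measure. -/
theorem measure_compl_sptStar (π : Measure (ℝ × ℝ)) [IsFiniteMeasure π] : π (sptStar π)ᶜ = 0 := by
  have hfib : ∀ x : ℝ, π ({x} ×ˢ univ \ sptStar π) = 0 := fun x => by
    rcases eq_or_ne (π.fst {x}) 0 with h0 | h0
    · refine measure_mono_null sdiff_subset ?_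
      rw [Measure.fst_apply (measurableSet_singleton x)] at h0
      rwa [show ({x} ×ˢ univ : Set (ℝ × ℝ)) = Prod.fst ⁻¹' {x} by ext; simp]
    · have hs : fiberMeasure π x (mSupport (fiberMeasure π x))ᶜ = 0 := by
        rw [mSupport_eq_support]
        exact Measure.measure_compl_support
      rw [fiberMeasure_apply (by
        rw [mSupport_eq_support]; exact Measure.isOpen_compl_support.measurableSet)] at hs
      refine measure_mono_null ?_ ((mul_eq_zero.1 hs).resolve_left
        (ENNReal.inv_ne_zero.2 (measure_ne_top _ _)))
      rintro ⟨a, b⟩ ⟨⟨ha, -⟩, hb⟩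
      obtain rfl : a = x := ha
      refine ⟨rfl, fun hb' => hb (Or.inr ?_)⟩
      exact mem_biUnion (show a ∈ {x | 0 < π.fst {x}} from pos_iff_ne_zero.2 h0) ⟨rfl, hb'⟩
  have hsupp : π (mSupport π)ᶜ = 0 := by
    rw [mSupport_eq_support]
    exact Measure.measure_compl_support
  refine measure_mono_null (t := (mSupport π)ᶜ ∪
    ⋃ x ∈ jumpSetMinus π, ({x} ×ˢ univ \ sptStar π)) ?_ (measure_union_null hsupp
      ((measure_biUnion_null_iff (countable_jumpSetMinus π)).2 fun x _ => hfib x))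
  rintro ⟨a, b⟩ hab
  by_cases hs : (a, b) ∈ mSupport π
  · refine Or.inr ?_
    by_cases ha : a ∈ jumpSetMinus π
    · exact mem_biUnion ha ⟨⟨rfl, trivial⟩, hab⟩
    · exact absurd (Or.inl ⟨hs, fun h => ha h.1⟩) hab
  · exact Or.inl hs

/-- Left-monotonicity of the support above base points outside `jumpSetMinus`. -/
theorem notMem_Ioo_of_notMem_jumpSetMinus {π : Measure (ℝ × ℝ)} {Γ : Set (ℝ × ℝ)}
    (hmono : ∀ x ym yp x' y' : ℝ, (x, ym) ∈ Γ → (x, yp) ∈ Γ → (x', y') ∈ Γ →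
      x < x' → ym < yp → y' ∉ Ioo ym yp)
    (hΓ : ∀ U : Set (ℝ × ℝ), π U ≠ 0 →
      ∃ p ∈ U, p ∈ Γ ∧ (∃ b ≤ p.1, (p.1, b) ∈ Γ) ∧ ∃ b ≥ p.1, (p.1, b) ∈ Γ)
    {x yp ym x' y' : ℝ} (hx : x ∉ jumpSetMinus π) (hp : (x, yp) ∈ mSupport π)
    (hm : (x, ym) ∈ mSupport π) (h' : (x', y') ∈ mSupport π) (hxx : x < x') :
    y' ∉ Ioo ym yp := by
  rintro ⟨hmy, hyp⟩
  have near : ∀ {a b : ℝ} {V W : Set ℝ}, (a, b) ∈ mSupport π → IsOpen V → a ∈ V → IsOpen W →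
      b ∈ W → ∃ c d, c ∈ V ∧ d ∈ W ∧ (c, d) ∈ Γ ∧ (∃ e ≤ c, (c, e) ∈ Γ) ∧ ∃ e ≥ c, (c, e) ∈ Γ := by
    intro a b V W hab hV ha hW hb
    obtain ⟨⟨c, d⟩, hcd, h⟩ := hΓ _ (hab _ (prod_mem_nhds (hV.mem_nhds ha) (hW.mem_nhds hb)))
    exact ⟨c, d, hcd.1, hcd.2, h⟩
  by_cases hA : x ∈ jumpSet π
  · have hright : ∀ ε > 0, ∃ z ∈ jumpSet π, x < z ∧ z < x + ε := by
      intro ε hε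
      by_contra! hcon
      exact hx ⟨hA, ε, hε, eq_empty_of_forall_notMem fun z hz =>
        absurd hz.1.2 (not_lt.2 (hcon z hz.2 hz.1.1))⟩
    have hypx : yp ≤ x := by
      by_contra! hlt
      obtain ⟨z, hzA, hxz, hzy⟩ := hright (yp - x) (by linarith)
      exact hp _ (prod_mem_nhds (Iio_mem_nhds hxz) (Ioi_mem_nhds (by linarith))) hzA
    obtain ⟨c, d, hc, hd, hcd, -⟩ := near h' isOpen_Ioi (show x' ∈ Ioi ((x + x') / 2) by
      simp only [mem_Ioi]; linarith) isOpen_Ioo (show y' ∈ Ioo ym yp from ⟨hmy, hyp⟩)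
    simp only [mem_Ioi, mem_Ioo] at hc hd
    obtain ⟨a, b, ha, hb, hab, -, e, hea, he⟩ := near hm isOpen_Ioo
      (show x ∈ Ioo d ((x + x') / 2) from ⟨by linarith, by linarith⟩) isOpen_Iio
      (show ym ∈ Iio d from hd.1)
    simp only [mem_Iio, mem_Ioo] at ha hb
    exact hmono a b e c d hab he hcd (by linarith) (by linarith) ⟨hb, by linarith⟩
  · obtain ⟨⟨u, v⟩, ⟨hu, hv⟩, huv, ⟨w, hwu, hw⟩, -⟩ := hΓ _ hA
    simp only [mem_Iio, mem_Ioi] at hu hv hwu hw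
    have hgap : ∀ a b, (a, b) ∈ Γ → u < a → b ∉ Ioo w v := fun a b hab hua =>
      hmono u w v a b hw huv hab hua (by linarith)
    have hy' : y' ∉ Ioo w v := by
      intro hy'
      obtain ⟨c, d, hc, hd, hcd, -⟩ := near h' isOpen_Ioi (show x' ∈ Ioi x from hxx) isOpen_Ioo hy'
      exact hgap c d hcd (hu.trans hc) hd
    have hxI : x ∈ Ioo u (min v ((x + x') / 2)) := ⟨hu, lt_min hv (by linarith)⟩
    rcases lt_or_ge w y' with hwy | hwy
    · have hvy : v ≤ y' := not_lt.1 fun h => hy' ⟨hwy, h⟩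
      obtain ⟨c, d, hc, hd, hcd, -⟩ := near h' isOpen_Ioi (show x' ∈ Ioi ((x + x') / 2) by
        simp only [mem_Ioi]; linarith) isOpen_Ioo (show y' ∈ Ioo w yp from ⟨hwy, hyp⟩)
      simp only [mem_Ioi, mem_Ioo] at hc hd
      obtain ⟨a, b, ha, hb, hab, ⟨e, hea, he⟩, -⟩ := near hp isOpen_Ioo hxI isOpen_Ioi
        (show yp ∈ Ioi d from hd.2)
      simp only [mem_Ioi, mem_Ioo, lt_min_iff] at ha hb
      have hew : e ≤ w := not_lt.1 fun h => hgap a e he ha.1 ⟨h, by linarith⟩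
      exact hmono a e b c d he hab hcd (by linarith) (by linarith) ⟨by linarith, hb⟩
    · obtain ⟨c, d, hc, hd, hcd, -⟩ := near h' isOpen_Ioi (show x' ∈ Ioi ((x + x') / 2) by
        simp only [mem_Ioi]; linarith) isOpen_Ioo
        (show y' ∈ Ioo ym v from ⟨hmy, by linarith⟩)
      simp only [mem_Ioi, mem_Ioo] at hc hd
      obtain ⟨a, b, ha, hb, hab, -, e, hea, he⟩ := near hm isOpen_Ioo hxI isOpen_Iio
        (show ym ∈ Iio d from hd.1)
      simp only [mem_Iio, mem_Ioo, lt_min_iff] at ha hb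
      have hve : v ≤ e := not_lt.1 fun h => hgap a e he ha.1 ⟨by linarith, h⟩
      exact hmono a b e c d hab he hcd (by linarith) (by linarith) ⟨hb, by linarith⟩

/-- characterisation of left-monotone couplings via the reduced support. -/
theorem leftMonotone_iff_sptStar (μ ν : Measure ℝ) (hμ : MemM μ) (hν : MemM ν)
    (π : Measure (ℝ × ℝ)) (hπ : IsMartCoupling π μ ν) :
    LeftMonotone π ↔
      ∀ x yp ym x' y' : ℝ, (x, yp) ∈ sptStar π → (x, ym) ∈ sptStar π →
        (x', y') ∈ sptStar π → x < x' → ym < yp → y' ∉ Set.Ioo ym yp := by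
  have hprob := hπ.1
  constructor
  · rintro ⟨Γ, hΓ, hfull, hmono⟩ x yp ym x' y' hp hm h' hxx hlt
    have hae := hπ.ae_exists_le_and_ge hμ hν hΓ ((mem_ae_iff_prob_eq_one hΓ).2 hfull)
    have hex : ∀ U : Set (ℝ × ℝ), π U ≠ 0 →
        ∃ p ∈ U, p ∈ Γ ∧ (∃ b ≤ p.1, (p.1, b) ∈ Γ) ∧ ∃ b ≥ p.1, (p.1, b) ∈ Γ := fun U hU =>
      (frequently_ae_mem_iff.2 hU |>.and_eventually hae).exists
    have hsub := sptStar_subset_mSupport π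
    by_cases hx : x ∈ jumpSetMinus π
    · have hfib : ∀ y, (x, y) ∈ sptStar π → y ∈ mSupport (fiberMeasure π x) := by
        rintro y (h | h)
        · exact absurd ⟨hx, trivial⟩ h.2
        · simp only [mem_iUnion, mem_prod, mem_singleton_iff] at h
          obtain ⟨_, -, rfl, hy⟩ := h
          exact hy
      rintro ⟨hmy, hyp⟩
      obtain ⟨⟨c, d⟩, ⟨hc, hd⟩, hcd, -⟩ := hex _ (hsub h' _
        (prod_mem_nhds (Ioi_mem_nhds hxx) (Ioo_mem_nhds hmy hyp)))
      obtain ⟨⟨a, b⟩, ⟨ha, hb⟩, hab, -⟩ := hex _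
        (measure_singleton_prod_ne_zero (hfib _ hp) isOpen_Ioi (show yp ∈ Ioi d from hd.2))
      obtain ⟨⟨a', e⟩, ⟨ha', he⟩, hae', -⟩ := hex _
        (measure_singleton_prod_ne_zero (hfib _ hm) isOpen_Iio (show ym ∈ Iio d from hd.1))
      obtain rfl : a = x := ha
      obtain rfl : a' = a := ha'
      exact hmono a' e b c d hae' hab hcd hc (lt_trans he hb) ⟨he, hb⟩
    · exact notMem_Ioo_of_notMem_jumpSetMinus hmono hex hx (hsub hp) (hsub hm) (hsub h') hxx
  · intro h
    have hsub : (toMeasurable π (sptStar π)ᶜ)ᶜ ⊆ sptStar π :=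
      compl_subset_comm.1 (subset_toMeasurable π (sptStar π)ᶜ)
    refine ⟨(toMeasurable π (sptStar π)ᶜ)ᶜ, (measurableSet_toMeasurable _ _).compl, ?_, ?_⟩
    · rw [prob_compl_eq_one_iff (measurableSet_toMeasurable _ _), measure_toMeasurable,
        measure_compl_sptStar]
    · exact fun x ym yp x' y' hm hp h' => h x yp ym x' y' (hsub hp) (hsub hm) (hsub h')

end
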